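/- Let T be a tree on n ≥ 4 vertices that is neither the star K_{1,n−1} nor the path P_n. Then the distance signless Laplacian spectral radius of the complement of T is strictly greater than that of the complement of P_n: μ₁(T̄) > μ₁(P̄_n). -/

import Mathlib

open SimpleGraph Matrix BigOperators Finset

noncomputable section

/-- Distance matrix of a graph on `Fin n`, with real entries. -/
def distM {n : ℕ} (G : SimpleGraph (Fin n)) : Matrix (Fin n) (Fin n) ℝ :=
  fun i j => (G.dist i j : ℝ)

/-- Transmission of a vertex: sum of distances to all vertices. -/
def transm {n : ℕ} (G : SimpleGraph (Fin n)) (i : Fin n) : ℝ :=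
  ∑ j, (G.dist i j : ℝ)

/-- Diagonal matrix of transmissions. -/
def trM {n : ℕ} (G : SimpleGraph (Fin n)) : Matrix (Fin n) (Fin n) ℝ :=
  Matrix.diagonal (transm G)

/-- Distance signless Laplacian. -/
def DQ {n : ℕ} (G : SimpleGraph (Fin n)) : Matrix (Fin n) (Fin n) ℝ :=
  trM G + distM G

/-- The `D_α` matrix. -/
def Dalpha {n : ℕ} (G : SimpleGraph (Fin n)) (α : ℝ) : Matrix (Fin n) (Fin n) ℝ :=
  α • trM G + (1 - α) • distM G

/-- Largest eigenvalue of a real matrix. -/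
def lam1 {n : ℕ} (M : Matrix (Fin n) (Fin n) ℝ) : ℝ :=
  sSup {t : ℝ | ∃ v : Fin n → ℝ, v ≠ 0 ∧ M.mulVec v = t • v}

/-- Degree of a vertex. -/
def deg {n : ℕ} (G : SimpleGraph (Fin n)) (x : Fin n) : ℕ :=
  (G.neighborSet x).ncard

/-- Number of pendant (degree-one) vertices. -/
def pendants {n : ℕ} (G : SimpleGraph (Fin n)) : ℕ :=
  {x : Fin n | deg G x = 1}.ncard

/-- Diameter: supremum of pairwise distances. -/
def gdiam {n : ℕ} (G : SimpleGraph (Fin n)) : ℕ :=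
  sSup {d : ℕ | ∃ x y : Fin n, G.dist x y = d}

/-- The graph obtained by moving all edges at `v` except `vw` to `u`. -/
def shift {n : ℕ} (T : SimpleGraph (Fin n)) (u v w : Fin n) : SimpleGraph (Fin n) :=
  SimpleGraph.fromRel (fun a b =>
    (T.Adj a b ∧ ((a ≠ v ∧ b ≠ v) ∨ (a = v ∧ b = w) ∨ (b = v ∧ a = w))) ∨
    (a = u ∧ T.Adj v b ∧ b ≠ w))

/-- `T₁` is obtained from `T` by a proper generalized tree shift. -/
def IsProperGTS {n : ℕ} (T T₁ : SimpleGraph (Fin n)) : Prop :=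
  ∃ (u v w : Fin n) (p : T.Walk u v), u ≠ v ∧ p.IsPath ∧
    T.Adj w v ∧ w ∈ p.support ∧
    (∀ x ∈ p.support, x ≠ u → x ≠ v → deg T x = 2) ∧
    deg T u ≠ 1 ∧ deg T v ≠ 1 ∧ T₁ = shift T u v w

/-- The Kelmans transformation at vertices `u`, `v`. -/
def kelmans {n : ℕ} (T : SimpleGraph (Fin n)) (u v : Fin n) : SimpleGraph (Fin n) :=
  SimpleGraph.fromRel (fun a b =>
    (T.Adj a b ∧ ¬(a = v ∧ ¬T.Adj u b ∧ b ≠ u) ∧ ¬(b = v ∧ ¬T.Adj u a ∧ a ≠ u)) ∨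
    (a = u ∧ T.Adj v b ∧ ¬T.Adj u b ∧ b ≠ u))

/-- Collapse the edge `ab` (identifying into `a`) and reuse `b` as a new pendant at `a`. -/
def collapseAddPendant {n : ℕ} (T : SimpleGraph (Fin n)) (a b : Fin n) : SimpleGraph (Fin n) :=
  SimpleGraph.fromRel (fun x y =>
    (x ≠ a ∧ x ≠ b ∧ y ≠ a ∧ y ≠ b ∧ T.Adj x y) ∨
    (x = a ∧ y ≠ a ∧ y ≠ b ∧ (T.Adj a y ∨ T.Adj b y)) ∨
    (x = a ∧ y = b))

/-- The star `K_{1,n-1}` with centre `0`. -/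
def starG (n : ℕ) [NeZero n] : SimpleGraph (Fin n) :=
  SimpleGraph.fromRel (fun a b => a = 0 ∨ b = 0)

/-- Irreducibility of a nonnegative matrix. -/
def IrreducibleM {n : ℕ} (M : Matrix (Fin n) (Fin n) ℝ) : Prop :=
  ∀ i j : Fin n, i ≠ j → ∃ k : ℕ, 0 < (M ^ k) i j


/-- `T` is a star: some centre is adjacent to exactly the other vertices, and
there are no other edges. -/
def IsStar {n : ℕ} (T : SimpleGraph (Fin n)) : Prop :=
  ∃ c : Fin n, ∀ a b : Fin n, T.Adj a b ↔ (a ≠ b ∧ (a = c ∨ b = c))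

/-- The all-ones matrix. -/
def Jmat (n : ℕ) : Matrix (Fin n) (Fin n) ℝ := Matrix.of fun _ _ => 1

/-- Signless Laplacian of a weight function. -/
def QM {n : ℕ} (c : Fin n → Fin n → ℝ) : Matrix (Fin n) (Fin n) ℝ :=
  Matrix.diagonal (fun i => ∑ j, c i j) + Matrix.of c

lemma DQ_eq_QM {n : ℕ} (G : SimpleGraph (Fin n)) :
    DQ G = QM (fun i j => (G.dist i j : ℝ)) := rfl

lemma QM_mulVec {n : ℕ} (c : Fin n → Fin n → ℝ) (v : Fin n → ℝ) (i : Fin n) :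
    (QM c).mulVec v i = ∑ j, c i j * (v i + v j) := by
  simp only [QM, Matrix.add_mulVec, Pi.add_apply, Matrix.mulVec_diagonal, mul_add,
    Finset.sum_add_distrib, Finset.sum_mul]
  rfl

lemma QM_qf {n : ℕ} (c : Fin n → Fin n → ℝ) (hc : ∀ i j, c i j = c j i) (v : Fin n → ℝ) :
    2 * (v ⬝ᵥ (QM c).mulVec v) = ∑ i, ∑ j, c i j * (v i + v j) ^ 2 := by
  have h1 : v ⬝ᵥ (QM c).mulVec v = ∑ i, ∑ j, c i j * (v i * (v i + v j)) := by
    simp only [dotProduct, QM_mulVec, Finset.mul_sum]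
    refine Finset.sum_congr rfl fun i _ => Finset.sum_congr rfl fun j _ => by ring
  have h2 : v ⬝ᵥ (QM c).mulVec v = ∑ i, ∑ j, c i j * (v j * (v i + v j)) := by
    rw [h1, Finset.sum_comm]
    refine Finset.sum_congr rfl fun i _ => Finset.sum_congr rfl fun j _ => ?_
    rw [hc j i]; ring
  rw [two_mul]
  nth_rw 1 [h1]
  rw [h2, ← Finset.sum_add_distrib]
  refine Finset.sum_congr rfl fun i _ => ?_
  rw [← Finset.sum_add_distrib]
  refine Finset.sum_congr rfl fun j _ => by ring

lemma QM_herm {n : ℕ} (c : Fin n → Fin n → ℝ) (hc : ∀ i j, c i j = c j i) :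
    (QM c).IsHermitian := by
  unfold QM
  refine Matrix.IsHermitian.add (Matrix.isHermitian_diagonal _) ?_
  ext i j
  simp [hc i j]

lemma eig_finite {n : ℕ} (M : Matrix (Fin n) (Fin n) ℝ) :
    {t : ℝ | ∃ v : Fin n → ℝ, v ≠ 0 ∧ M.mulVec v = t • v}.Finite := by
  refine (Module.End.finite_hasEigenvalue (Matrix.toLin' M)).subset ?_
  rintro t ⟨v, hv, h⟩
  refine Module.End.hasEigenvalue_of_hasEigenvector (x := v) ⟨?_, hv⟩
  rw [Module.End.mem_eigenspace_iff]
  simpa using h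

lemma le_lam1 {n : ℕ} (M : Matrix (Fin n) (Fin n) ℝ) (t : ℝ) (v : Fin n → ℝ) (hv : v ≠ 0)
    (h : M.mulVec v = t • v) : t ≤ lam1 M :=
  le_csSup (eig_finite M).bddAbove ⟨v, hv, h⟩

lemma lam1_psd {n : ℕ} (M : Matrix (Fin n) (Fin n) ℝ) (hM : M.IsHermitian) :
    (lam1 M • (1 : Matrix (Fin n) (Fin n) ℝ) - M).PosSemidef := by
  have hH : (lam1 M • (1 : Matrix (Fin n) (Fin n) ℝ) - M).IsHermitian := by
    refine Matrix.IsHermitian.sub ?_ hM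
    ext i j
    simp [Matrix.one_apply, eq_comm]
  rw [hH.posSemidef_iff_eigenvalues_nonneg]
  intro i
  have h := hH.mulVec_eigenvectorBasis i
  have hne : (⇑(hH.eigenvectorBasis i) : Fin n → ℝ) ≠ 0 := by
    intro h0
    apply (hH.eigenvectorBasis.orthonormal.ne_zero i)
    ext j
    exact congrFun h0 j
  have := le_lam1 M (lam1 M - hH.eigenvalues i) _ hne (by
    rw [Matrix.sub_mulVec, Matrix.smul_mulVec, Matrix.one_mulVec] at h
    rw [sub_smul, ← h]; abel)
  simp only [Pi.zero_apply]
  linarith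

lemma lam1_qf {n : ℕ} (M : Matrix (Fin n) (Fin n) ℝ) (hM : M.IsHermitian) (v : Fin n → ℝ) :
    v ⬝ᵥ M.mulVec v ≤ lam1 M * (v ⬝ᵥ v) := by
  have := (lam1_psd M hM).dotProduct_mulVec_nonneg v
  simp only [star_trivial, Matrix.sub_mulVec, Matrix.smul_mulVec, Matrix.one_mulVec,
    dotProduct_sub, dotProduct_smul, smul_eq_mul] at this
  linarith

lemma lam1_qf_eq {n : ℕ} (M : Matrix (Fin n) (Fin n) ℝ) (hM : M.IsHermitian) (v : Fin n → ℝ)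
    (h : lam1 M * (v ⬝ᵥ v) ≤ v ⬝ᵥ M.mulVec v) : M.mulVec v = lam1 M • v := by
  have h2 := lam1_qf M hM v
  have := ((lam1_psd M hM).dotProduct_mulVec_zero_iff v).1 (by
    simp only [star_trivial, Matrix.sub_mulVec, Matrix.smul_mulVec, Matrix.one_mulVec,
      dotProduct_sub, dotProduct_smul, smul_eq_mul]
    linarith)
  simp only [Matrix.sub_mulVec, Matrix.smul_mulVec, Matrix.one_mulVec] at this
  exact (sub_eq_zero.1 this).symm

lemma lam1_attained {n : ℕ} (hn : 0 < n) (M : Matrix (Fin n) (Fin n) ℝ) (hM : M.IsHermitian) :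
    ∃ v : Fin n → ℝ, v ≠ 0 ∧ M.mulVec v = lam1 M • v := by
  have hne : {t : ℝ | ∃ v : Fin n → ℝ, v ≠ 0 ∧ M.mulVec v = t • v}.Nonempty := by
    refine ⟨hM.eigenvalues ⟨0, hn⟩, _, ?_, hM.mulVec_eigenvectorBasis ⟨0, hn⟩⟩
    intro h0
    apply (hM.eigenvectorBasis.orthonormal.ne_zero ⟨0, hn⟩)
    ext j
    exact congrFun h0 j
  exact hne.csSup_mem (eig_finite M)

lemma lam1_mono {n : ℕ} (hn : 0 < n) (c c' : Fin n → Fin n → ℝ) (hc : ∀ i j, c i j = c j i)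
    (hc' : ∀ i j, c' i j = c' j i) (h : ∀ i j, c i j ≤ c' i j) :
    lam1 (QM c) ≤ lam1 (QM c') := by
  obtain ⟨v, hv, he⟩ := lam1_attained hn (QM c) (QM_herm c hc)
  have h1 := lam1_qf (QM c') (QM_herm c' hc') v
  have h2 := QM_qf c hc v
  have h3 := QM_qf c' hc' v
  have h4 : ∑ i, ∑ j, c i j * (v i + v j) ^ 2 ≤ ∑ i, ∑ j, c' i j * (v i + v j) ^ 2 :=
    Finset.sum_le_sum fun i _ => Finset.sum_le_sum fun j _ =>
      mul_le_mul_of_nonneg_right (h i j) (sq_nonneg _)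
  have h5 : v ⬝ᵥ (QM c).mulVec v = lam1 (QM c) * (v ⬝ᵥ v) := by
    rw [he, dotProduct_smul, smul_eq_mul]
  have h6 : 0 < v ⬝ᵥ v := by
    simpa using (dotProduct_star_self_pos_iff (v := v)).2 hv
  have : lam1 (QM c) * (v ⬝ᵥ v) ≤ lam1 (QM c') * (v ⬝ᵥ v) := by linarith
  exact le_of_mul_le_mul_right this h6

lemma lam1_reindex {n : ℕ} (c : Fin n → Fin n → ℝ) (e : Fin n ≃ Fin n) :
    lam1 (QM (fun i j => c (e i) (e j))) = lam1 (QM c) := by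
  have key : ∀ (c : Fin n → Fin n → ℝ) (e : Fin n ≃ Fin n) (t : ℝ),
      (∃ v : Fin n → ℝ, v ≠ 0 ∧ (QM c).mulVec v = t • v) →
      (∃ v : Fin n → ℝ, v ≠ 0 ∧ (QM (fun i j => c (e i) (e j))).mulVec v = t • v) := by
    rintro c e t ⟨v, hv, h⟩
    refine ⟨v ∘ e, fun h0 => hv ?_, ?_⟩
    · ext i
      simpa using congrFun h0 (e.symm i)
    · ext i
      have := congrFun h (e i)
      rw [QM_mulVec] at this ⊢
      simp only [Pi.smul_apply, Function.comp] at this ⊢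
      rw [← this]
      exact Equiv.sum_comp e (fun j => c (e i) j * (v (e i) + v j))
  unfold lam1
  congr 1
  ext t
  refine ⟨fun h => ?_, key c e t⟩
  simpa using key _ e.symm t h

/-- Positive Perron vector, symmetric under reversal. -/
lemma perron {n : ℕ} (hn : 2 ≤ n) (c : Fin n → Fin n → ℝ) (hc : ∀ i j, c i j = c j i)
    (hpos : ∀ i j, i ≠ j → 0 < c i j) (h0 : ∀ i, 0 ≤ c i i)
    (hrev : ∀ i j, c (Fin.rev i) (Fin.rev j) = c i j) :
    ∃ x : Fin n → ℝ, (∀ i, 0 < x i) ∧ (∀ i, x (Fin.rev i) = x i) ∧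
      (QM c).mulVec x = lam1 (QM c) • x := by
  obtain ⟨v, hv, he⟩ := lam1_attained (by omega) (QM c) (QM_herm c hc)
  have hnn : ∀ i j, 0 ≤ c i j := fun i j => by
    rcases eq_or_ne i j with h | h
    · subst h; exact h0 i
    · exact (hpos i j h).le
  set a : Fin n → ℝ := fun i => |v i| with ha
  have hea : (QM c).mulVec a = lam1 (QM c) • a := by
    apply lam1_qf_eq _ (QM_herm c hc)
    have h1 : a ⬝ᵥ a = v ⬝ᵥ v := by simp [dotProduct, ha]
    have h2 := QM_qf c hc v
    have h3 := QM_qf c hc a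
    have h4 : ∑ i, ∑ j, c i j * (v i + v j) ^ 2 ≤ ∑ i, ∑ j, c i j * (a i + a j) ^ 2 := by
      refine Finset.sum_le_sum fun i _ => Finset.sum_le_sum fun j _ =>
        mul_le_mul_of_nonneg_left ?_ (hnn i j)
      rw [← sq_abs (v i + v j)]
      exact pow_le_pow_left₀ (abs_nonneg _) (abs_add_le _ _) 2
    have h5 : v ⬝ᵥ (QM c).mulVec v = lam1 (QM c) * (v ⬝ᵥ v) := by
      rw [he, dotProduct_smul, smul_eq_mul]
    rw [h1]; linarith
  have han : ∀ i, 0 ≤ a i := fun i => abs_nonneg _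
  have hap : ∀ i, 0 < a i := by
    intro i
    rcases (han i).lt_or_eq with h | h
    · exact h
    exfalso
    have h1 := congrFun hea i
    rw [QM_mulVec, Pi.smul_apply, ← h, smul_zero] at h1
    have h2 := (Finset.sum_eq_zero_iff_of_nonneg (fun j _ =>
      mul_nonneg (hnn i j) (by linarith [han j]))).1 h1
    apply hv
    ext j
    by_cases hij : i = j
    · subst hij; exact abs_eq_zero.1 h.symm
    · have := h2 j (Finset.mem_univ j)
      rcases mul_eq_zero.1 this with h3 | h3
      · exact absurd h3 (hpos i j hij).ne'
      · exact abs_eq_zero.1 (by change a j = 0; linarith)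
  have heb : (QM c).mulVec (fun i => a (Fin.rev i)) = lam1 (QM c) • (fun i => a (Fin.rev i)) := by
    ext i
    have := congrFun hea (Fin.rev i)
    rw [QM_mulVec] at this ⊢
    simp only [Pi.smul_apply] at this ⊢
    rw [← this, ← Equiv.sum_comp Fin.revPerm]
    refine Finset.sum_congr rfl fun j _ => ?_
    simp only [Fin.revPerm_apply, Fin.rev_rev]
    rw [← hrev i (Fin.rev j), Fin.rev_rev]
  refine ⟨a + fun i => a (Fin.rev i), fun i => add_pos (hap _) (hap _), fun i => ?_, ?_⟩
  · simp [add_comm]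
  · rw [Matrix.mulVec_add, hea, heb, smul_add]

lemma tree_order (m : ℕ) : ∀ (V : Type) [Fintype V] (T : SimpleGraph V), T.IsTree →
    Fintype.card V = m + 1 → ∀ p : V,
    ∃ (u : ℕ → V) (q : ℕ → ℕ),
      (∀ i j, i < m + 1 → j < m + 1 → u i = u j → i = j) ∧
      (∀ v, ∃ i, i < m + 1 ∧ u i = v) ∧
      (∀ i, i < m → i < q i ∧ q i < m + 1) ∧
      (∀ i, i + 1 < m → i + 2 ≤ q i) ∧
      (∀ i j, i < j → j < m + 1 → (T.Adj (u i) (u j) ↔ j = q i)) ∧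
      (1 ≤ m → u 0 ≠ p) := by
  classical
  induction m with
  | zero =>
    intro V _ T hT hcard p
    have hs : Subsingleton V := (Fintype.card_le_one_iff_subsingleton).1 (by omega)
    refine ⟨fun _ => p, fun _ => 0, ?_, ?_, ?_, ?_, ?_, ?_⟩
    · intros; omega
    · intro v; exact ⟨0, by omega, Subsingleton.elim _ _⟩
    · intros; omega
    · intros; omega
    · intros; omega
    · intros; omega
  | succ m ih =>
    intro V _ T hT hcard p
    have hnt : Nontrivial V := Fintype.one_lt_card_iff_nontrivial.1 (by omega)
    obtain ⟨l, hlp, hl⟩ : ∃ l, l ≠ p ∧ T.degree l = 1 := by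
      obtain ⟨a, b, hab, ha, hb⟩ := hT.exists_ne_and_degree_eq_one
      by_cases h : a = p
      · exact ⟨b, fun h' => hab (h.trans h'.symm), hb⟩
      · exact ⟨a, h, ha⟩
    obtain ⟨z, hz, hzu⟩ := degree_eq_one_iff_existsUnique_adj.1 hl
    have hT' : (T.induce {l}ᶜ).IsTree :=
      ⟨hT.connected.induce_compl_singleton_of_degree_eq_one hl, hT.isAcyclic.induce _⟩
    have hzl : z ∈ ({l}ᶜ : Set V) := by
      simp only [Set.mem_compl_iff, Set.mem_singleton_iff]
      exact hz.ne'
    have hc' : Fintype.card ({l}ᶜ : Set V) = m + 1 := by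
      rw [Fintype.card_compl_set, hcard]; simp
    obtain ⟨u, q, h1, h2, h3, h4, h5, h6⟩ := ih _ (T.induce {l}ᶜ) hT' hc' ⟨z, hzl⟩
    obtain ⟨k, hk, hku⟩ := h2 ⟨z, hzl⟩
    have hul : ∀ i, (u i : V) ≠ l := fun i => (u i).2
    refine ⟨fun i => if i = 0 then l else u (i - 1),
      fun i => if i = 0 then k + 1 else q (i - 1) + 1, ?_, ?_, ?_, ?_, ?_, ?_⟩
    · intro i j hi hj hij
      rcases i with _ | i <;> rcases j with _ | j
      · rfl
      · simp only [if_true, Nat.add_eq_zero_iff, one_ne_zero, and_false, if_false,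
          Nat.add_sub_cancel] at hij
        exact absurd hij.symm (hul j)
      · simp only [if_true, Nat.add_eq_zero_iff, one_ne_zero, and_false, if_false,
          Nat.add_sub_cancel] at hij
        exact absurd hij (hul i)
      · simp only [Nat.add_eq_zero_iff, one_ne_zero, and_false, if_false,
          Nat.add_sub_cancel] at hij
        rw [h1 i j (by omega) (by omega) (Subtype.ext hij)]
    · intro v
      by_cases hv : v = l
      · exact ⟨0, by omega, by simp [hv]⟩
      · obtain ⟨i, hi, hiv⟩ := h2 ⟨v, hv⟩
        exact ⟨i + 1, by omega, by simp [hiv]⟩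
    · intro i hi
      rcases i with _ | i
      · simp; omega
      · have := h3 i (by omega)
        simp; omega
    · intro i hi
      rcases i with _ | i
      · have : k ≠ 0 := by
          rintro rfl
          exact h6 (by omega) hku
        simp; omega
      · have := h4 i (by omega)
        simp; omega
    · intro i j hij hj
      obtain ⟨j, rfl⟩ : ∃ j', j = j' + 1 := ⟨j - 1, by omega⟩
      rcases i with _ | i
      · simp only [if_true, Nat.add_eq_zero_iff, one_ne_zero, and_false, if_false,
          Nat.add_sub_cancel]
        constructor
        · intro h
          have : u j = u k := by rw [hku]; exact Subtype.ext (hzu _ h)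
          rw [h1 j k (by omega) hk this]
        · intro h
          have : j = k := by omega
          rw [this, hku]; exact hz
      · have := h5 i j (by omega) (by omega)
        simp only [Nat.add_eq_zero_iff, one_ne_zero, and_false, if_false,
          Nat.add_sub_cancel]
        simp only [SimpleGraph.comap_adj, Function.Embedding.subtype_apply, SimpleGraph.induce] at this
        rw [this]; omega
    · intro _; simpa using hlp

lemma compl_conn {n : ℕ} (hn : 4 ≤ n) (T : SimpleGraph (Fin n)) (hT : T.IsTree)
    (hstar : ¬ IsStar T) : Tᶜ.Connected := by
  have tri : ∀ a b c, T.Adj a b → T.Adj b c → T.Adj c a → False := by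
    intro a b c h1 h2 h3
    refine hT.isAcyclic (Walk.cons h1 (Walk.cons h2 (Walk.cons h3 Walk.nil))) ?_
    have := h1.ne; have := h2.ne; have := h3.ne
    simp [Walk.isCycle_def, Walk.isTrail_def, *]
    grind
  have quad : ∀ a b c d, a ≠ c → b ≠ d → T.Adj a b → T.Adj b c → T.Adj c d → T.Adj d a →
      False := by
    intro a b c d hac hbd h1 h2 h3 h4
    refine hT.isAcyclic (Walk.cons h1 (Walk.cons h2 (Walk.cons h3 (Walk.cons h4 Walk.nil)))) ?_
    have := h1.ne; have := h2.ne; have := h3.ne; have := h4.ne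
    simp [Walk.isCycle_def, Walk.isTrail_def, *]
    grind
  -- a vertex adjacent to all others is the centre of a star
  have dom : ∀ c, ∃ k, k ≠ c ∧ ¬ T.Adj k c := by
    intro c
    by_contra! h
    refine hstar ⟨c, fun a b => ⟨fun hab => ⟨hab.ne, ?_⟩, ?_⟩⟩
    · by_contra! h'
      exact tri a b c hab (h b h'.2) (h a h'.1).symm
    · rintro ⟨hab, rfl | rfl⟩
      · exact (h b hab.symm).symm
      · exact h a hab
  have adjR : ∀ i j, i ≠ j → ¬ T.Adj i j → Tᶜ.Reachable i j := fun i j h1 h2 =>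
    Adj.reachable (by rw [compl_adj]; exact ⟨h1, h2⟩)
  have : Nonempty (Fin n) := ⟨⟨0, by omega⟩⟩
  refine ⟨fun i j => ?_⟩
  by_cases hij : i = j
  · subst hij; exact Reachable.refl _
  by_cases hadj : T.Adj i j
  · obtain ⟨b, hbi, hb⟩ := dom i
    obtain ⟨a, haj, ha⟩ := dom j
    -- b not adjacent to i, a not adjacent to j
    by_cases hbj : T.Adj b j
    · by_cases hai : T.Adj a i
      · have hab : a ≠ b := by rintro rfl; exact ha hbj
        have : ¬ T.Adj a b := fun h => quad i a b j hbi.symm haj hai.symm h hbj hadj.symm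
        exact (adjR i b hbi.symm (fun h => hb h.symm)).trans
          ((adjR b a hab.symm (fun h => this h.symm)).trans (adjR a j haj ha))
      · have : a ≠ i := by rintro rfl; exact ha hadj
        exact (adjR i a this.symm (fun h => hai h.symm)).trans (adjR a j haj ha)
    · have : b ≠ j := by rintro rfl; exact hb hadj.symm
      exact (adjR i b hbi.symm (fun h => hb h.symm)).trans (adjR b j this hbj)
  · exact adjR i j hij hadj

/-- Rank adjacency: `i` and `j` are joined when the larger one is the `q`-image of the smaller. -/
def radj (q : ℕ → ℕ) (i j : ℕ) : Prop := (i < j ∧ j = q i) ∨ (j < i ∧ i = q j)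

open Classical in
/-- Edge part of the weight. -/
def eg {n : ℕ} (q : ℕ → ℕ) (i j : Fin n) : ℝ := if radj q i j then 1 else 0

/-- Weight: one for distinct vertices, plus one for adjacent ones. -/
def wt {n : ℕ} (q : ℕ → ℕ) (i j : Fin n) : ℝ := (if i = j then 0 else 1) + eg q i j

/-- Zigzag successor. -/
def q0 (n : ℕ) (i : ℕ) : ℕ := if i + 2 < n then i + 2 else i + 1

lemma radj_symm (q : ℕ → ℕ) (i j : ℕ) : radj q i j ↔ radj q j i := by
  unfold radj; tauto

lemma eg_symm {n : ℕ} (q : ℕ → ℕ) (i j : Fin n) : eg q i j = eg q j i := by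
  unfold eg; rw [radj_symm]

lemma wt_symm {n : ℕ} (q : ℕ → ℕ) (i j : Fin n) : wt q i j = wt q j i := by
  unfold wt; rw [eg_symm]; simp only [eq_comm]

/-- The zigzag enumeration of path positions, outside in. -/
def zig (n : ℕ) : Fin n ≃ Fin n where
  toFun i := ⟨if i.val % 2 = 0 then i.val / 2 else n - 1 - i.val / 2, by have := i.2; split <;> omega⟩
  invFun i := ⟨if 2 * i.val < n then 2 * i.val else 2 * (n - 1 - i.val) + 1, by
    have := i.2; split <;> omega⟩
  left_inv i := by
    have := i.2
    ext; simp only; split_ifs <;> omega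
  right_inv i := by
    have := i.2
    ext; simp only; split_ifs <;> omega

lemma zig_val {n : ℕ} (i : Fin n) : (zig n i).val =
    if i.val % 2 = 0 then i.val / 2 else n - 1 - i.val / 2 := rfl

lemma zig_radj {n : ℕ} (i j : Fin n) :
    radj Nat.succ (zig n i).val (zig n j).val ↔ radj (q0 n) i j := by
  have := i.2
  have := j.2
  simp only [radj, zig_val, q0, Nat.succ_eq_add_one]
  split_ifs <;> omega

lemma wt_zig {n : ℕ} (i j : Fin n) : wt Nat.succ (zig n i) (zig n j) = wt (q0 n) i j := by
  have h := zig_radj i j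
  simp only [wt, eg, EmbeddingLike.apply_eq_iff_eq]
  congr 1
  classical exact if_congr h rfl rfl

lemma path_radj {n : ℕ} (i j : Fin n) : (pathGraph n).Adj i j ↔ radj Nat.succ i j := by
  rw [pathGraph_adj]; unfold radj
  simp only [Nat.succ_eq_add_one]; omega

/-- For `n ≥ 5` the complement of the path has the expected distances. -/
lemma path_dist {n : ℕ} (hn : 5 ≤ n) (i j : Fin n) :
    (((pathGraph n)ᶜ.dist i j : ℕ) : ℝ) = wt Nat.succ i j := by
  unfold wt eg
  by_cases hij : i = j
  · subst hij
    have : ¬ radj Nat.succ i.val i.val := by unfold radj; omega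
    simp [this]
  by_cases hadj : (pathGraph n).Adj i j
  · have hr := (path_radj i j).1 hadj
    rw [if_neg hij, if_pos hr]
    obtain ⟨k, hki, hkj, hk1, hk2⟩ : ∃ k : Fin n, k ≠ i ∧ k ≠ j ∧ ¬ (pathGraph n).Adj i k ∧
        ¬ (pathGraph n).Adj k j := by
      have hi := i.2
      have hj := j.2
      rw [pathGraph_adj] at hadj
      simp only [pathGraph_adj, ne_eq, Fin.ext_iff]
      by_cases h1 : 2 ≤ i.val ∧ 2 ≤ j.val
      · exact ⟨⟨0, by omega⟩, by simp only; omega⟩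
      · exact ⟨⟨4, by omega⟩, by simp only; omega⟩
    have a1 : (pathGraph n)ᶜ.Adj i k := by rw [compl_adj]; exact ⟨hki.symm, hk1⟩
    have a2 : (pathGraph n)ᶜ.Adj k j := by rw [compl_adj]; exact ⟨hkj, hk2⟩
    have hle : (pathGraph n)ᶜ.dist i j ≤ 2 := dist_le (Walk.cons a1 (Walk.cons a2 Walk.nil))
    have hlt := (a1.reachable.trans a2.reachable).one_lt_dist_of_ne_of_not_adj hij
      (by rw [compl_adj]; tauto)
    have : (pathGraph n)ᶜ.dist i j = 2 := by omega
    rw [this]; norm_num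
  · have hr : ¬ radj Nat.succ i.val j.val := fun h => hadj ((path_radj i j).2 h)
    rw [if_neg hij, if_neg hr]
    have : (pathGraph n)ᶜ.dist i j = 1 := by
      rw [dist_eq_one_iff_adj, compl_adj]; exact ⟨hij, hadj⟩
    rw [this]; norm_num

/-- Unimodality of a symmetric solution of the path recurrence. -/
lemma unimodal {n : ℕ} (hn : 5 ≤ n) (X : ℕ → ℝ) (κ S : ℝ) (hκ : 4 ≤ κ)
    (hpos : ∀ i, i < n → 0 < X i) (hsym : ∀ i, i < n → X (n - 1 - i) = X i)
    (E0 : κ * X 0 = S + X 0 + X 1)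
    (E : ∀ i, i + 2 < n → κ * X (i + 1) = S + 2 * X (i + 1) + X i + X (i + 2)) :
    ∀ i, 2 * i + 2 < n → X i ≤ X (i + 1) := by
  classical
  intro i hi
  by_contra! hlt
  have hex : ∃ i, X (i + 1) < X i := ⟨i, hlt⟩
  set m := Nat.find hex with hm
  have hm1 : X (m + 1) < X m := Nat.find_spec hex
  have hm2 : m ≤ i := Nat.find_min' hex hlt
  have hm0 : m ≠ 0 := by
    intro h0
    rw [h0] at hm1
    have e1 := E 0 (by omega)
    have p1 := hpos 1 (by omega)
    have p2 := hpos 2 (by omega)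
    norm_num at e1 hm1
    nlinarith
  have hprev : X (m - 1) ≤ X m := by
    have := Nat.find_min hex (m := m - 1) (by omega)
    have h1 : m - 1 + 1 = m := by omega
    rw [h1] at this
    exact not_lt.1 this
  have step : ∀ j, m + j + 1 < n →
      X (m + j + 1) < X (m + j) ∧ X (m + j + 1) - X (m + j) ≤ X (m + j) - X (m + j - 1) := by
    intro j
    induction j with
    | zero =>
      intro _
      refine ⟨hm1, ?_⟩
      simp only [Nat.add_zero]
      linarith
    | succ j ih =>
      intro hj
      obtain ⟨h1, h2⟩ := ih (by omega)
      have e1 := E (m + j) (by omega)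
      have e0 := E (m + j - 1) (by omega)
      have h3 : m + j - 1 + 1 = m + j := by omega
      have h4 : m + j - 1 + 2 = m + j + 1 := by omega
      rw [h3, h4] at e0
      have h5 : m + (j + 1) + 1 = m + j + 2 := by omega
      have h6 : m + (j + 1) - 1 = m + j := by omega
      rw [h5, h6]
      rw [show m + (j + 1) = m + j + 1 by omega]
      have : X (m + j + 2) - X (m + j + 1) ≤ X (m + j + 1) - X (m + j) := by
        nlinarith
      exact ⟨by linarith, this⟩
  have := (step (n - 2 - 2 * m) (by omega)).1
  have s1 := hsym m (by omega)
  have s2 := hsym (m + 1) (by omega)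
  rw [show m + (n - 2 - 2 * m) + 1 = n - 1 - m by omega,
    show m + (n - 2 - 2 * m) = n - 1 - (m + 1) by omega, s1, s2] at this
  linarith

/-- Splitting a row of the eigen-equation. -/
lemma wt_row {n : ℕ} (q : ℕ → ℕ) (v : Fin n → ℝ) (i : Fin n) :
    ∑ j, wt q i j * (v i + v j) =
      ((n : ℝ) - 2) * v i + ∑ j, v j + ∑ j, eg q i j * (v i + v j) := by
  simp only [wt, add_mul, Finset.sum_add_distrib, ite_mul, zero_mul, one_mul]
  congr 1
  have : ∀ j, (if i = j then (0:ℝ) else v i + v j) = (v i + v j) - if i = j then v i + v j else 0 := by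
    intro j; split_ifs <;> simp
  simp only [this, Finset.sum_sub_distrib, Finset.sum_add_distrib, Finset.sum_ite_eq,
    Finset.mem_univ, if_true]
  simp
  ring

lemma eg_nonneg {n : ℕ} (q : ℕ → ℕ) (i j : Fin n) : 0 ≤ eg q i j := by
  unfold eg; split_ifs <;> norm_num

/-- The sorted positive Perron vector of the zigzag path. -/
lemma path_vec {n : ℕ} (hn : 5 ≤ n) : ∃ w : Fin n → ℝ, (∀ i, 0 < w i) ∧
    (∀ i j, i ≤ j → w i ≤ w j) ∧
    (QM (wt (q0 n))).mulVec w = lam1 (QM (wt (n := n) (q0 n))) • w := by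
  obtain ⟨x, hx, hs, he⟩ := perron (n := n) (by omega) (wt Nat.succ) (wt_symm _)
    (fun i j h => by
      have := eg_nonneg Nat.succ i j
      unfold wt; rw [if_neg h]; linarith)
    (fun i => by
      have := eg_nonneg Nat.succ i i
      unfold wt; simpa using this)
    (fun i j => by
      have hi := i.2
      have hj := j.2
      have : radj Nat.succ (Fin.rev i).val (Fin.rev j).val ↔ radj Nat.succ i.val j.val := by
        simp only [radj, Fin.val_rev, Nat.succ_eq_add_one]; omega
      simp only [wt, eg, Fin.rev_inj]
      congr 1
      classical exact if_congr this rfl rfl)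
  set lam := lam1 (QM (wt (n := n) Nat.succ)) with hlam
  have row : ∀ i, ((n : ℝ) - 2) * x i + ∑ j, x j + ∑ j, eg Nat.succ i j * (x i + x j)
      = lam * x i := by
    intro i
    have := congrFun he i
    rw [QM_mulVec, wt_row] at this
    simpa using this
  have hlamge : (n : ℝ) + 2 ≤ lam := by
    obtain ⟨i, -, hi⟩ := Finset.exists_min_image Finset.univ x ⟨⟨0, by omega⟩, Finset.mem_univ _⟩
    have r := row i
    have h1 : (n : ℝ) * x i ≤ ∑ j, x j := by
      have := Finset.card_nsmul_le_sum Finset.univ x (x i) hi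
      simpa using this
    have h2 : 0 ≤ ∑ j, eg Nat.succ i j * (x i + x j) :=
      Finset.sum_nonneg fun j _ => mul_nonneg (eg_nonneg _ _ _) (by linarith [hx i, hx j])
    have h3 : (5 : ℝ) ≤ n := by exact_mod_cast hn
    have h4 : (2 * (n : ℝ) - 2) * x i ≤ lam * x i := by linarith
    have := le_of_mul_le_mul_right h4 (hx i)
    linarith
  set X : ℕ → ℝ := fun k => if h : k < n then x ⟨k, h⟩ else 0 with hX
  have Xx : ∀ i : Fin n, X i.val = x i := fun i => by simp [hX]
  have Xs : ∀ i, i < n → X (n - 1 - i) = X i := by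
    intro i hi
    have := hs ⟨i, hi⟩
    rw [← Xx, ← Xx, Fin.val_rev] at this
    rw [← this]; congr 1; simp only; omega
  have uni := unimodal hn X (lam - (n - 2)) (∑ j, x j) (by linarith)
    (fun i hi => by rw [← Fin.val_mk hi, Xx]; exact hx _) Xs
    (by
      have r := row ⟨0, by omega⟩
      have es : ∑ j : Fin n, eg Nat.succ ⟨0, by omega⟩ j * (x ⟨0, by omega⟩ + x j) =
          X 0 + X 1 := by
       rw [Finset.sum_eq_single (⟨1, by omega⟩ : Fin n)]
       · have : radj Nat.succ 0 1 := by simp [radj]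
         simp only [eg, this, if_true, ← Xx, one_mul]
       · intro j _ hj
         have : ¬ radj Nat.succ 0 j.val := by
           simp only [radj, ne_eq, Fin.ext_iff, Nat.succ_eq_add_one] at hj ⊢; omega
         simp [eg, this]
       · simp
      rw [es, ← Xx ⟨0, by omega⟩] at r
      simp only at r
      linarith)
    (by
      intro i hi
      have r := row ⟨i + 1, by omega⟩
      have es : ∑ j : Fin n, eg Nat.succ ⟨i + 1, by omega⟩ j * (x ⟨i + 1, by omega⟩ + x j) =
          (X (i + 1) + X i) + (X (i + 1) + X (i + 2)) := by
       rw [← Finset.sum_subset (Finset.subset_univ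
         {(⟨i, by omega⟩ : Fin n), ⟨i + 2, by omega⟩})]
       · rw [Finset.sum_pair (by simp [Fin.ext_iff])]
         have a1 : radj Nat.succ (i + 1) i := by simp [radj]
         have a2 : radj Nat.succ (i + 1) (i + 2) := by simp [radj]
         simp only [eg, a1, a2, if_true, ← Xx, one_mul]
       · intro j _ hj
         have : ¬ radj Nat.succ (i + 1) j.val := by
           simp only [radj, Finset.mem_insert, Finset.mem_singleton, Fin.ext_iff,
             Nat.succ_eq_add_one] at hj ⊢; omega
         simp [eg, this]
      rw [es, ← Xx ⟨i + 1, by omega⟩] at r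
      simp only at r
      linarith)
  have mono : ∀ b, 2 * b < n + 0 → ∀ a, a ≤ b → X a ≤ X b := by
    intro b
    induction b with
    | zero => intro _ a ha; rw [Nat.le_zero.1 ha]
    | succ b ih =>
      intro hb a ha
      rcases Nat.lt_or_ge a (b + 1) with h | h
      · exact (ih (by omega) a (by omega)).trans (uni b (by omega))
      · rw [le_antisymm ha h]
  have wX : ∀ i : Fin n, x (zig n i) = X (i.val / 2) := by
    intro i
    have hi := i.2
    rw [← Xx, zig_val]
    split_ifs
    · rfl
    · exact Xs _ (by omega)
  refine ⟨fun i => x (zig n i), fun i => hx _, fun i j hij => ?_, ?_⟩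
  · simp only [wX]
    have := j.2
    have hij' : i.val ≤ j.val := hij
    exact mono _ (by omega) _ (by omega)
  · have hw : wt (n := n) (q0 n) = fun i j => wt Nat.succ (zig n i) (zig n j) := by
      ext i j; rw [wt_zig]
    have hl : lam1 (QM (wt (n := n) (q0 n))) = lam := by rw [hw, lam1_reindex]
    rw [hl]
    ext i
    have := congrFun he (zig n i)
    rw [QM_mulVec] at this ⊢
    simp only [Pi.smul_apply] at this ⊢
    rw [← this, ← Equiv.sum_comp (zig n) (fun j => wt Nat.succ (zig n i) j * (x (zig n i) + x j))]
    exact Finset.sum_congr rfl fun j _ => by rw [wt_zig]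

open Classical in
lemma eg_qf {n : ℕ} (q : ℕ → ℕ) (w : Fin n → ℝ) :
    ∑ i, ∑ j, eg q i j * (w i + w j) ^ 2 =
      2 * ∑ i : Fin n, ∑ j : Fin n,
        (if i.val < j.val ∧ j.val = q i then (w i + w j) ^ 2 else 0) := by
  have h : ∀ i j : Fin n, eg q i j * (w i + w j) ^ 2 =
      (if i.val < j.val ∧ j.val = q i then (w i + w j) ^ 2 else 0) +
      (if j.val < i.val ∧ i.val = q j then (w j + w i) ^ 2 else 0) := by
    intro i j
    unfold eg radj
    by_cases h1 : i.val < j.val ∧ j.val = q i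
    · have h2 : ¬ (j.val < i.val ∧ i.val = q j) := by omega
      rw [if_pos (Or.inl h1), if_pos h1, if_neg h2]; ring
    · by_cases h2 : j.val < i.val ∧ i.val = q j
      · rw [if_pos (Or.inr h2), if_neg h1, if_pos h2]; ring
      · rw [if_neg (not_or.2 ⟨h1, h2⟩), if_neg h1, if_neg h2]; ring
  simp only [h, Finset.sum_add_distrib]
  rw [two_mul]
  congr 1
  exact Finset.sum_comm

open Classical in
lemma inner_eq {n : ℕ} (q : ℕ → ℕ) (w : Fin n → ℝ) (i : Fin n) (h1 : i.val < q i) (h2 : q i < n) :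
    ∑ j : Fin n, (if i.val < j.val ∧ j.val = q i then (w i + w j) ^ 2 else 0) =
      (w i + w ⟨q i, h2⟩) ^ 2 := by
  rw [Finset.sum_eq_single (⟨q i, h2⟩ : Fin n)]
  · simp [h1]
  · intro j _ hj
    rw [if_neg]
    rintro ⟨-, h⟩
    exact hj (Fin.ext h)
  · simp

/-- Core comparison. -/
lemma core {n : ℕ} (hn : 5 ≤ n) (q : ℕ → ℕ) (hq1 : ∀ i, i + 1 < n → i < q i ∧ q i < n)
    (hq2 : ∀ i, i + 2 < n → i + 2 ≤ q i) (k : ℕ) (hk2 : 2 ≤ k) (hkn : k + 1 < n)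
    (hk : ∀ i, i + 1 < n → q i ≠ k) :
    lam1 (QM (wt (n := n) (q0 n))) < lam1 (QM (wt (n := n) q)) := by
  classical
  obtain ⟨w, hw, hmono, he⟩ := path_vec hn
  by_contra! hle
  have hq0 : ∀ i, i + 1 < n → i < q0 n i ∧ q0 n i < n ∧ q0 n i ≤ q i := by
    intro i hi
    have := hq1 i hi
    have := hq2 i
    unfold q0; split_ifs <;> omega
  set F : (ℕ → ℕ) → Fin n → ℝ := fun q i =>
    ∑ j : Fin n, (if i.val < j.val ∧ j.val = q i then (w i + w j) ^ 2 else 0) with hF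
  have hFle : ∀ i, F (q0 n) i ≤ F q i := by
    intro i
    have hi := i.2
    by_cases h : i.val + 1 < n
    · have a := hq0 i h
      have b := hq1 i h
      simp only [hF]
      rw [inner_eq q w i b.1 b.2, inner_eq (q0 n) w i a.1 a.2.1]
      have : w ⟨q0 n i, a.2.1⟩ ≤ w ⟨q i, b.2⟩ := hmono _ _ a.2.2
      exact pow_le_pow_left₀ (by linarith [hw i, hw ⟨q0 n i, a.2.1⟩]) (by linarith) 2
    · simp only [hF]
      apply le_of_eq
      refine Finset.sum_congr rfl fun j _ => ?_
      have := j.2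
      rw [if_neg (by omega), if_neg (by omega)]
  have hsplit : ∀ q, 2 * (w ⬝ᵥ (QM (wt q)).mulVec w) =
      (∑ i, ∑ j, (if i = j then (0:ℝ) else 1) * (w i + w j) ^ 2) + 2 * ∑ i, F q i := by
    intro q
    rw [QM_qf _ (wt_symm q), ← eg_qf, ← Finset.sum_add_distrib]
    refine Finset.sum_congr rfl fun i _ => ?_
    rw [← Finset.sum_add_distrib]
    refine Finset.sum_congr rfl fun j _ => ?_
    unfold wt; ring
  have s1 := hsplit q
  have s0 := hsplit (q0 n)
  have hww : 0 ≤ w ⬝ᵥ w := by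
    unfold dotProduct
    exact Finset.sum_nonneg fun i _ => mul_self_nonneg _
  have h5 : w ⬝ᵥ (QM (wt (q0 n))).mulVec w = lam1 (QM (wt (n := n) (q0 n))) * (w ⬝ᵥ w) := by
    rw [he, dotProduct_smul, smul_eq_mul]
  have h6 := lam1_qf (QM (wt q)) (QM_herm _ (wt_symm q)) w
  have h7 := mul_le_mul_of_nonneg_right hle hww
  have h8 : ∑ i, F (q0 n) i ≤ ∑ i, F q i := Finset.sum_le_sum fun i _ => hFle i
  -- the eigen-equation for `q`
  have heq := lam1_qf_eq (QM (wt q)) (QM_herm _ (wt_symm q)) w (by linarith)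
  have hlameq : lam1 (QM (wt (n := n) q)) * (w ⬝ᵥ w) = lam1 (QM (wt (n := n) (q0 n))) * (w ⬝ᵥ w) := by
    linarith
  have hwpos : w ⬝ᵥ w ≠ 0 := by
    unfold dotProduct
    exact (Finset.sum_pos (fun i _ => mul_pos (hw i) (hw i))
      ⟨⟨0, by omega⟩, Finset.mem_univ _⟩).ne'
  have hlam := mul_right_cancel₀ hwpos hlameq
  have a := hq0 k hkn
  have b := hq1 k hkn
  set K : Fin n := ⟨k, by omega⟩ with hK
  -- tightness at `k`
  have tight : w ⟨q k, b.2⟩ = w ⟨q0 n k, a.2.1⟩ := by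
    have hsum : ∑ i, F (q0 n) i = ∑ i, F q i := by linarith
    have := (Finset.sum_eq_sum_iff_of_le (fun i _ => hFle i)).1 hsum K (Finset.mem_univ _)
    simp only [hF] at this
    rw [inner_eq q w K b.1 b.2, inner_eq (q0 n) w K a.1 a.2.1] at this
    have p1 := hw K
    have p2 := hw ⟨q k, b.2⟩
    have p3 := hw ⟨q0 n k, a.2.1⟩
    have := (pow_left_inj₀ (by positivity) (by positivity) two_ne_zero).1 this
    have h9 : w ⟨q0 n k, a.2.1⟩ = w ⟨q k, b.2⟩ := by simpa using this
    exact h9.symm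
  have r1 := congrFun heq K
  have r0 := congrFun he K
  rw [QM_mulVec, wt_row] at r1 r0
  rw [hlam] at r1
  have e1 : ∑ j, eg q K j * (w K + w j) = w K + w ⟨q k, b.2⟩ := by
    rw [Finset.sum_eq_single (⟨q k, b.2⟩ : Fin n)]
    · have : radj q k (q k) := Or.inl ⟨b.1, rfl⟩
      simp [eg, hK, this]
    · intro j _ hj
      have : ¬ radj q k j.val := by
        rintro (⟨-, h⟩ | ⟨h', h⟩)
        · exact hj (Fin.ext h)
        · exact hk j.val (by omega) h.symm
      simp [eg, hK, this]
    · simp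
  have e0 : w K + w ⟨q0 n k, a.2.1⟩ + (w K + w ⟨k - 2, by omega⟩) ≤
      ∑ j, eg (q0 n) K j * (w K + w j) := by
    have hne : (⟨q0 n k, a.2.1⟩ : Fin n) ≠ ⟨k - 2, by omega⟩ := by
      simp only [ne_eq, Fin.ext_iff]; omega
    have := Finset.sum_le_sum_of_subset_of_nonneg (f := fun j => eg (q0 n) K j * (w K + w j))
      (Finset.subset_univ {(⟨q0 n k, a.2.1⟩ : Fin n), ⟨k - 2, by omega⟩})
      (fun j _ _ => mul_nonneg (eg_nonneg _ _ _) (by linarith [hw K, hw j]))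
    rw [Finset.sum_pair hne] at this
    have r1 : radj (q0 n) k (q0 n k) := Or.inl ⟨a.1, rfl⟩
    have r2 : radj (q0 n) k (k - 2) := by
      refine Or.inr ⟨by omega, ?_⟩
      unfold q0; split_ifs <;> omega
    simpa [eg, hK, r1, r2] using this
  rw [e1] at r1
  have p1 := hw K
  have p2 := hw ⟨k - 2, by omega⟩
  linarith

lemma missing {n : ℕ} (q : ℕ → ℕ) (hq1 : ∀ i, i + 1 < n → i < q i ∧ q i < n)
    (hq2 : ∀ i, i + 2 < n → i + 2 ≤ q i)
    (h : ∀ k, 2 ≤ k → k + 1 < n → ∃ i, i + 1 < n ∧ q i = k) :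
    ∀ i, i + 2 < n → q i = i + 2 := by
  intro i
  induction i using Nat.strong_induction_on with
  | _ i ih =>
    intro hi
    have h1 := hq2 i hi
    have h2 := hq1 i (by omega)
    by_cases hlast : i + 3 < n
    · obtain ⟨i', hi', hqi⟩ := h (i + 2) (by omega) (by omega)
      have h3 := hq1 i' hi'
      have h4 : i' + 2 < n := by omega
      have h5 := hq2 i' h4
      rcases Nat.lt_or_ge i' i with h6 | h6
      · have := ih i' h6 h4; omega
      · have : i' = i := by omega
        rw [← this]; omega
    · omega

theorem stmt_11 (n : ℕ) (hn : 4 ≤ n) (T : SimpleGraph (Fin n)) (hT : T.IsTree)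
    (hstar : ¬ IsStar T) (hpath : ¬ Nonempty (T ≃g SimpleGraph.pathGraph n)) :
    lam1 (DQ Tᶜ) > lam1 (DQ (SimpleGraph.pathGraph n)ᶜ) := by
  obtain ⟨u, q, hu1, hu2, hq1', hq2', hadj', -⟩ :=
    tree_order (n - 1) (Fin n) T hT (by simp; omega) ⟨0, by omega⟩
  have hn1 : n - 1 + 1 = n := by omega
  rw [hn1] at hu1 hu2 hq1' hadj'
  have hq1 : ∀ i, i + 1 < n → i < q i ∧ q i < n := fun i hi => hq1' i (by omega)
  have hq2 : ∀ i, i + 2 < n → i + 2 ≤ q i := fun i hi => hq2' i (by omega)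
  have hinj : Function.Injective (fun i : Fin n => u i.val) := fun i j h =>
    Fin.ext (hu1 i j i.2 j.2 h)
  let e : Fin n ≃ Fin n := Equiv.ofBijective (fun i : Fin n => u i.val)
    ⟨hinj, fun v => by obtain ⟨i, hi, h⟩ := hu2 v; exact ⟨⟨i, hi⟩, h⟩⟩
  have he : ∀ i : Fin n, e i = u i.val := fun i => rfl
  have hadj : ∀ i j : Fin n, T.Adj (e i) (e j) ↔ radj q i j := by
    intro i j
    rw [he, he]
    rcases lt_trichotomy i.val j.val with h | h | h
    · rw [hadj' i j h j.2]; unfold radj; omega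
    · have : i = j := Fin.ext h
      subst this
      simp [radj]
    · rw [T.adj_comm, hadj' j i h i.2]; unfold radj; omega
  by_cases hall : ∀ k, 2 ≤ k → k + 1 < n → ∃ i, i + 1 < n ∧ q i = k
  · exfalso
    have hm := missing q hq1 hq2 hall
    apply hpath
    refine ⟨⟨e.symm.trans (zig n), ?_⟩⟩
    intro a b
    rw [path_radj]
    obtain ⟨i, rfl⟩ := e.surjective a
    obtain ⟨j, rfl⟩ := e.surjective b
    rw [hadj]
    simp only [Equiv.trans_apply, Equiv.symm_apply_apply]
    rw [zig_radj]
    have hqq : ∀ i, i + 1 < n → q i = q0 n i := by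
      intro i hi
      have := hm i
      have := hq1 i hi
      unfold q0; split_ifs <;> omega
    have hi := i.2
    have hj := j.2
    unfold radj
    constructor
    · rintro (⟨h, h'⟩ | ⟨h, h'⟩)
      · exact Or.inl ⟨h, by rw [hqq _ (by omega)]; exact h'⟩
      · exact Or.inr ⟨h, by rw [hqq _ (by omega)]; exact h'⟩
    · rintro (⟨h, h'⟩ | ⟨h, h'⟩)
      · exact Or.inl ⟨h, by rw [← hqq _ (by omega)]; exact h'⟩
      · exact Or.inr ⟨h, by rw [← hqq _ (by omega)]; exact h'⟩
  · push Not at hall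
    obtain ⟨k, hk2, hkn, hk⟩ := hall
    rcases Nat.lt_or_ge n 5 with h4 | h5
    · exfalso
      have hn4 : n = 4 := by omega
      have hall3 : ∀ i, i + 1 < n → q i = 3 := by
        intro i hi
        have := hq1 i hi
        have := hq2 i
        have := hk i hi
        omega
      apply hstar
      refine ⟨e ⟨3, by omega⟩, fun a b => ?_⟩
      obtain ⟨i, rfl⟩ := e.surjective a
      obtain ⟨j, rfl⟩ := e.surjective b
      rw [hadj]
      simp only [ne_eq, EmbeddingLike.apply_eq_iff_eq, Fin.ext_iff]
      have hi := i.2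
      have hj := j.2
      have := hall3 i.val
      have := hall3 j.val
      unfold radj
      omega
    · have hconn := compl_conn hn T hT hstar
      have hcore := core h5 q hq1 hq2 k hk2 hkn hk
      have hP : lam1 (DQ (SimpleGraph.pathGraph n)ᶜ) = lam1 (QM (wt (n := n) (q0 n))) := by
        have hw : wt (n := n) (q0 n) = fun i j => wt Nat.succ (zig n i) (zig n j) := by
          ext i j; rw [wt_zig]
        rw [hw, lam1_reindex, DQ_eq_QM]
        congr 2
        ext i j
        exact path_dist h5 i j
      have hTT : lam1 (QM (wt (n := n) q)) ≤ lam1 (DQ Tᶜ) := by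
        rw [DQ_eq_QM, ← lam1_reindex (fun i j => (Tᶜ.dist i j : ℝ)) e]
        refine lam1_mono (by omega) _ _ (wt_symm q) (fun i j => by rw [dist_comm]) ?_
        intro i j
        unfold wt eg
        by_cases hij : i = j
        · subst hij
          have : ¬ radj q i.val i.val := by unfold radj; omega
          simp [this]
        have hij' : e i ≠ e j := fun h => hij (e.injective h)
        rw [if_neg hij]
        by_cases hr : radj q i j
        · rw [if_pos hr]
          have := hconn.one_lt_dist_of_ne_of_not_adj hij' (by
            rw [compl_adj, not_and, not_not]; exact fun _ => (hadj i j).2 hr)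
          have h2 : (2 : ℝ) ≤ (Tᶜ.dist (e i) (e j) : ℝ) := by exact_mod_cast this
          linarith
        · rw [if_neg hr]
          have := hconn.pos_dist_of_ne hij'
          have h2 : (1 : ℝ) ≤ (Tᶜ.dist (e i) (e j) : ℝ) := by exact_mod_cast this
          linarith
      rw [hP]
      exact lt_of_lt_of_le hcore hTT
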